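/- arXiv:math/9810152 — 6 statements merged into one kernel-verified Lean document; each statement's English description precedes it below -/
import Mathlib

section
/- Let A_n be the n-th Weyl algebra over a field k, with V_n the 2n-dimensional subspace spanned by the generators x_1,…,x_n,y_1,…,y_n and with the standard filtration F_m = (k·1 + V_n)^m. If g is a filtered endomorphism of A_n (a k-algebra endomorphism with g(F_m) ⊆ F_m for all m), then there exist a [-,-]-map σ : V_n → V_n and a k-linear map ε : V_n → k such that g(v) = σ(v) + ε(v)·1 for all v ∈ V_n. Moreover, if σ is bijective, then g is a filtered automorphism of A_n. -/
open FreeAlgebra in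
/-- The defining relations of the `n`-th Weyl algebra: `[x_i, x_j] = [y_i, y_j] = 0` and
`[y_i, x_j] = δᵢⱼ`, written as rewriting relations on the free algebra on
`x_1, …, x_n, y_1, …, y_n` (the `x`'s indexed by `Sum.inl`, the `y`'s by `Sum.inr`). -/
inductive WeylRel (k : Type) [Field k] (n : ℕ) :
    FreeAlgebra k (Fin n ⊕ Fin n) → FreeAlgebra k (Fin n ⊕ Fin n) → Prop
  | xx (i j : Fin n) : WeylRel k n (ι k (.inl i) * ι k (.inl j)) (ι k (.inl j) * ι k (.inl i))
  | yy (i j : Fin n) : WeylRel k n (ι k (.inr i) * ι k (.inr j)) (ι k (.inr j) * ι k (.inr i))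
  | yx (i j : Fin n) : WeylRel k n (ι k (.inr i) * ι k (.inl j))
      (ι k (.inl j) * ι k (.inr i) + if i = j then 1 else 0)

/-- The `n`-th Weyl algebra `A_n` over `k`. -/
abbrev Weyl (k : Type) [Field k] (n : ℕ) : Type := RingQuot (WeylRel k n)

/-- The images in `A_n` of the generators of the free algebra. -/
noncomputable def weylGen (k : Type) [Field k] (n : ℕ) (s : Fin n ⊕ Fin n) : Weyl k n :=
  RingQuot.mkAlgHom k (WeylRel k n) (FreeAlgebra.ι k s)

/-- The subspace `V_n ⊆ A_n` spanned by the generators `x_1, …, x_n, y_1, …, y_n`. -/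
noncomputable def weylV (k : Type) [Field k] (n : ℕ) : Submodule k (Weyl k n) :=
  Submodule.span k (Set.range (weylGen k n))

/-- The standard filtration `F_m = (k·1 + V_n)^m` of the Weyl algebra. -/
noncomputable def weylF (k : Type) [Field k] (n : ℕ) (m : ℕ) : Submodule k (Weyl k n) :=
  ((1 : Submodule k (Weyl k n)) ⊔ weylV k n) ^ m

/-- The generator `x_i`, as an element of `V_n`. -/
noncomputable def weylX (k : Type) [Field k] (n : ℕ) (i : Fin n) : weylV k n :=
  ⟨weylGen k n (.inl i), Submodule.subset_span ⟨.inl i, rfl⟩⟩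

/-- The generator `y_i`, as an element of `V_n`. -/
noncomputable def weylY (k : Type) [Field k] (n : ℕ) (i : Fin n) : weylV k n :=
  ⟨weylGen k n (.inr i), Submodule.subset_span ⟨.inr i, rfl⟩⟩

theorem weylX_lie_weylX (k : Type) [Field k] (n : ℕ) (i j : Fin n) :
    ⁅(weylX k n i : Weyl k n), (weylX k n j : Weyl k n)⁆ = 0 := by
  have h := RingQuot.mkAlgHom_rel k (WeylRel.xx (k := k) i j)
  simp only [map_mul] at h
  exact sub_eq_zero.mpr h

theorem weylY_lie_weylY (k : Type) [Field k] (n : ℕ) (i j : Fin n) :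
    ⁅(weylY k n i : Weyl k n), (weylY k n j : Weyl k n)⁆ = 0 := by
  have h := RingQuot.mkAlgHom_rel k (WeylRel.yy (k := k) i j)
  simp only [map_mul] at h
  exact sub_eq_zero.mpr h

theorem weylY_lie_weylX (k : Type) [Field k] (n : ℕ) (i j : Fin n) :
    ⁅(weylY k n i : Weyl k n), (weylX k n j : Weyl k n)⁆ = if i = j then 1 else 0 := by
  have h := RingQuot.mkAlgHom_rel k (WeylRel.yx (k := k) i j)
  simp only [map_add, map_mul, apply_ite (RingQuot.mkAlgHom k (WeylRel k n)), map_one,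
    map_zero] at h
  exact sub_eq_iff_eq_add'.mpr h

/-- Commutators of elements of `V_n` are scalars. -/
theorem weylV_lie_mem (k : Type) [Field k] (n : ℕ) (u v : weylV k n) :
    ⁅(u : Weyl k n), (v : Weyl k n)⁆ ∈ (⊥ : Subalgebra k (Weyl k n)) := by
  have gen (s t : Fin n ⊕ Fin n) :
      ⁅weylGen k n s, weylGen k n t⁆ ∈ (⊥ : Subalgebra k (Weyl k n)) := by
    rcases s with i | i <;> rcases t with j | j
    · exact weylX_lie_weylX k n i j ▸ zero_mem _
    · rw [Ring.lie_def, ← neg_sub, ← Ring.lie_def]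
      refine neg_mem ?_
      have h := weylY_lie_weylX k n j i
      rw [show ⁅weylGen k n (.inr j), weylGen k n (.inl i)⁆ = _ from h]
      split_ifs
      exacts [one_mem _, zero_mem _]
    · rw [show ⁅weylGen k n (.inr i), weylGen k n (.inl j)⁆ = _ from weylY_lie_weylX k n i j]
      split_ifs
      exacts [one_mem _, zero_mem _]
    · exact weylY_lie_weylY k n i j ▸ zero_mem _
  obtain ⟨u, hu⟩ := u
  obtain ⟨v, hv⟩ := v
  simp only
  induction hu, hv using Submodule.span_induction₂ with
  | mem_mem x y hx hy =>
    obtain ⟨s, rfl⟩ := hx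
    obtain ⟨t, rfl⟩ := hy
    exact gen s t
  | zero_left y hy => simp [Ring.lie_def]
  | zero_right x hx => simp [Ring.lie_def]
  | add_left x y z _ _ _ h₁ h₂ =>
    rw [Ring.lie_def, add_mul, mul_add, add_sub_add_comm]
    exact add_mem h₁ h₂
  | add_right x y z _ _ _ h₁ h₂ =>
    rw [Ring.lie_def, add_mul, mul_add, add_sub_add_comm]
    exact add_mem h₁ h₂
  | smul_left r x y _ _ h =>
    rw [Ring.lie_def, smul_mul_assoc, mul_smul_comm, ← smul_sub]
    exact Subalgebra.smul_mem _ h r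
  | smul_right r x y _ _ h =>
    rw [Ring.lie_def, smul_mul_assoc, mul_smul_comm, ← smul_sub]
    exact Subalgebra.smul_mem _ h r

/-- Adding scalars does not change commutators. -/
theorem lie_add_algebraMap {k A : Type*} [CommRing k] [Ring A] [Algebra k A] (a b : A) (c d : k) :
    ⁅a + algebraMap k A c, b + algebraMap k A d⁆ = ⁅a, b⁆ := by
  simp only [Ring.lie_def, add_mul, mul_add, Algebra.commutes c b, Algebra.commutes d a,
    Algebra.commutes c (algebraMap k A d)]
  abel

/-- A linear map on `V_n` satisfying the Weyl relations extends to an algebra homomorphism. -/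
theorem exists_algHom_of_lie (k : Type) [Field k] (n : ℕ) {A : Type*} [Ring A] [Algebra k A]
    (τ : weylV k n →ₗ[k] A)
    (hxx : ∀ i j, ⁅τ (weylX k n i), τ (weylX k n j)⁆ = 0)
    (hyy : ∀ i j, ⁅τ (weylY k n i), τ (weylY k n j)⁆ = 0)
    (hyx : ∀ i j, ⁅τ (weylY k n i), τ (weylX k n j)⁆ = if i = j then 1 else 0) :
    ∃ h : Weyl k n →ₐ[k] A, ∀ v : weylV k n, h v = τ v := by
  let f : FreeAlgebra k (Fin n ⊕ Fin n) →ₐ[k] A :=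
    FreeAlgebra.lift k fun s => τ ⟨weylGen k n s, Submodule.subset_span ⟨s, rfl⟩⟩
  have hf : ∀ ⦃x y⦄, WeylRel k n x y → f x = f y := by
    intro x y hxy
    cases hxy with
    | xx i j => simpa [f, weylX] using sub_eq_zero.mp (hxx i j)
    | yy i j => simpa [f, weylY] using sub_eq_zero.mp (hyy i j)
    | yx i j =>
      simpa [f, weylX, weylY, apply_ite (FreeAlgebra.lift k _)] using sub_eq_iff_eq_add'.mp (hyx i j)
  refine ⟨RingQuot.liftAlgHom k ⟨f, hf⟩, ?_⟩
  rintro ⟨v, hv⟩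
  induction hv using Submodule.span_induction with
  | mem x hx =>
    obtain ⟨s, rfl⟩ := hx
    simp [weylGen, f]
  | zero => exact (map_zero _).trans (map_zero τ).symm
  | add x y hx hy h₁ h₂ =>
    simp only [map_add] at *
    rw [h₁, h₂, ← map_add]; rfl
  | smul r x hx h =>
    simp only [map_smul] at *
    rw [h, ← map_smul]; rfl

/-- The Weyl algebra is generated by `V_n`. -/
theorem weyl_subalgebra_eq_top (k : Type) [Field k] (n : ℕ) (S : Subalgebra k (Weyl k n))
    (hS : ∀ v : weylV k n, (v : Weyl k n) ∈ S) : S = ⊤ := by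
  rw [eq_top_iff]
  intro a _
  obtain ⟨p, rfl⟩ := RingQuot.mkAlgHom_surjective k (WeylRel k n) a
  induction p using FreeAlgebra.induction with
  | grade0 r => rw [AlgHom.commutes]; exact S.algebraMap_mem r
  | grade1 s => exact hS ⟨weylGen k n s, Submodule.subset_span ⟨s, rfl⟩⟩
  | mul a b ha hb => rw [map_mul]; exact mul_mem (ha trivial) (hb trivial)
  | add a b ha hb => rw [map_add]; exact add_mem (ha trivial) (hb trivial)

/-- A linear map into `F_1` splits into a `V_n`-valued part and a scalar part. -/
theorem exists_linearMap_add_algebraMap (k : Type) [Field k] (n : ℕ) {M : Type*} [AddCommGroup M]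
    [Module k M] (f : M →ₗ[k] Weyl k n) (hf : ∀ v, f v ∈ weylF k n 1) :
    ∃ (σ : M →ₗ[k] weylV k n) (ε : M →ₗ[k] k),
      ∀ v, f v = (σ v : Weyl k n) + algebraMap k (Weyl k n) (ε v) := by
  let p : weylV k n × k →ₗ[k] Weyl k n :=
    (weylV k n).subtype.coprod (Algebra.linearMap k (Weyl k n))
  have hp : ∀ v, f v ∈ LinearMap.range p := by
    intro v
    have h := hf v
    rw [weylF, pow_one, Submodule.mem_sup] at h
    obtain ⟨y, hy, z, hz, h⟩ := h
    obtain ⟨c, rfl⟩ := Submodule.mem_one.mp hy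
    exact ⟨(⟨z, hz⟩, c), by simp [p, ← h, add_comm]⟩
  obtain ⟨q, hq⟩ := Module.projective_lifting_property p.rangeRestrict (f.codRestrict _ hp)
    p.surjective_rangeRestrict
  refine ⟨LinearMap.fst k _ _ ∘ₗ q, LinearMap.snd k _ _ ∘ₗ q, fun v => ?_⟩
  have h := congrArg Subtype.val (LinearMap.congr_fun hq v)
  simpa [p] using h.symm

/-- **Lemma 4.3.** If `g` is a filtered endomorphism of the Weyl algebra `A_n` (a `k`-algebra
endomorphism with `g(F_m) ⊆ F_m` for all `m`), then there exist a `[-,-]`-map `σ : V_n → V_n`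
(i.e. `[σ x_i, σ x_j] = [σ y_i, σ y_j] = 0` and `[σ y_i, σ x_j] = δᵢⱼ` in `A_n`) and a linear
map `ε : V_n → k` such that `g(v) = σ(v) + ε(v)·1` for all `v ∈ V_n`; moreover if `σ` is
bijective then `g` is a (filtered) automorphism of `A_n`. -/
theorem stmt_2 (k : Type) [Field k] (n : ℕ) (g : Weyl k n →ₐ[k] Weyl k n)
    (hg : ∀ m : ℕ, ∀ a ∈ weylF k n m, g a ∈ weylF k n m) :
    ∃ (σ : weylV k n →ₗ[k] weylV k n) (ε : weylV k n →ₗ[k] k),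
      (∀ v : weylV k n, g v = (σ v : Weyl k n) + algebraMap k (Weyl k n) (ε v)) ∧
      (∀ i j : Fin n, ⁅(σ (weylX k n i) : Weyl k n), (σ (weylX k n j) : Weyl k n)⁆ = 0) ∧
      (∀ i j : Fin n, ⁅(σ (weylY k n i) : Weyl k n), (σ (weylY k n j) : Weyl k n)⁆ = 0) ∧
      (∀ i j : Fin n, ⁅(σ (weylY k n i) : Weyl k n), (σ (weylX k n j) : Weyl k n)⁆
          = if i = j then 1 else 0) ∧
      (Function.Bijective σ → Function.Bijective g) := by
  have hgV (v : weylV k n) : g v ∈ weylF k n 1 :=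
    hg 1 v (by rw [weylF, pow_one]; exact Submodule.mem_sup_right v.2)
  obtain ⟨σ, ε, hσ⟩ :=
    exists_linearMap_add_algebraMap k n (M := weylV k n)
      (g.toLinearMap.domRestrict (weylV k n)) hgV
  replace hσ : ∀ v : weylV k n, g v = (σ v : Weyl k n) + algebraMap k (Weyl k n) (ε v) := hσ
  have lie_σ (u v : weylV k n) :
      ⁅(σ u : Weyl k n), (σ v : Weyl k n)⁆ = ⁅(u : Weyl k n), (v : Weyl k n)⁆ := by
    rw [← lie_add_algebraMap _ _ (ε u) (ε v), ← hσ, ← hσ]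
    obtain ⟨c, hc⟩ := Algebra.mem_bot.mp (weylV_lie_mem k n u v)
    calc ⁅g u, g v⁆ = g ⁅(u : Weyl k n), (v : Weyl k n)⁆ := by simp [Ring.lie_def]
      _ = _ := by rw [← hc, AlgHom.commutes]
  refine ⟨σ, ε, hσ, fun i j => ?_, fun i j => ?_, fun i j => ?_, fun hb => ?_⟩
  · rw [lie_σ, weylX_lie_weylX]
  · rw [lie_σ, weylY_lie_weylY]
  · rw [lie_σ, weylY_lie_weylX]
  let e := LinearEquiv.ofBijective σ hb
  have hσe (w : weylV k n) : σ (e.symm w) = w := e.apply_symm_apply w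
  let τ : weylV k n →ₗ[k] Weyl k n :=
    ((weylV k n).subtype - Algebra.linearMap k (Weyl k n) ∘ₗ ε) ∘ₗ e.symm.toLinearMap
  have τ_apply (w : weylV k n) :
      τ w = (e.symm w : Weyl k n) + algebraMap k (Weyl k n) (-ε (e.symm w)) := by
    simp [τ, sub_eq_add_neg]
  have lie_τ (u v : weylV k n) : ⁅τ u, τ v⁆ = ⁅(u : Weyl k n), (v : Weyl k n)⁆ := by
    rw [τ_apply, τ_apply, lie_add_algebraMap, ← lie_σ, hσe, hσe]
  obtain ⟨h, hh⟩ := exists_algHom_of_lie k n τ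
    (fun i j => by rw [lie_τ, weylX_lie_weylX])
    (fun i j => by rw [lie_τ, weylY_lie_weylY])
    (fun i j => by rw [lie_τ, weylY_lie_weylX])
  have left_inv : AlgHom.equalizer (h.comp g) (AlgHom.id k (Weyl k n)) = ⊤ := by
    refine weyl_subalgebra_eq_top k n _ fun v => ?_
    have hv : e.symm (σ v) = v := e.symm_apply_apply v
    change h (g v) = v
    rw [hσ, map_add, AlgHom.commutes, hh, τ_apply, hv, map_neg, neg_add_cancel_right]
  have range_eq : g.range = ⊤ := by
    refine weyl_subalgebra_eq_top k n _ fun v => ?_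
    have hv : (v : Weyl k n) = g (e.symm v) - algebraMap k (Weyl k n) (ε (e.symm v)) := by
      rw [hσ, hσe, add_sub_cancel_right]
    rw [hv]
    exact sub_mem ⟨_, rfl⟩ (g.range.algebraMap_mem _)
  refine ⟨Function.LeftInverse.injective (g := h) fun a => ?_, AlgHom.range_eq_top g |>.mp range_eq⟩
  exact (left_inv ▸ Algebra.mem_top : a ∈ AlgHom.equalizer (h.comp g) (AlgHom.id k (Weyl k n)))
end

section
/- Every filtered endomorphism of the n-th Weyl algebra A_n over a field k is an automorphism. That is, if g is a k-algebra endomorphism of A_n with g(F_m) ⊆ F_m for all m, where F_m = (k·1 + V_n)^m is the standard filtration, then g is bijective. -/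
open Matrix

theorem weylGen_commutator (k : Type) [Field k] (n : ℕ) (s t : Fin n ⊕ Fin n) :
    weylGen k n s * weylGen k n t - weylGen k n t * weylGen k n s =
      algebraMap k (Weyl k n) (J (Fin n) k s t) := by
  have yx (i j : Fin n) : weylGen k n (.inr i) * weylGen k n (.inl j) =
      weylGen k n (.inl j) * weylGen k n (.inr i) + if i = j then 1 else 0 := by
    have := RingQuot.mkAlgHom_rel k (WeylRel.yx (k := k) i j)
    split_ifs at this ⊢ <;> simpa [weylGen] using this
  rcases s with i | i <;> rcases t with j | j
  · have := RingQuot.mkAlgHom_rel k (WeylRel.xx (k := k) i j)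
    rw [map_mul, map_mul] at this
    simpa [J, weylGen, sub_eq_zero] using this
  · rw [yx]
    by_cases h : j = i
    · simp [J, h]
    · simp [J, h, Ne.symm h]
  · rw [yx]
    by_cases h : i = j <;> simp [J, h]
  · have := RingQuot.mkAlgHom_rel k (WeylRel.yy (k := k) i j)
    rw [map_mul, map_mul] at this
    simpa [J, weylGen, sub_eq_zero] using this

theorem weyl_exists_algHom {k : Type} [Field k] {n : ℕ} {A : Type*} [Ring A] [Algebra k A]
    (w : Fin n ⊕ Fin n → A)
    (hw : ∀ s t, w s * w t - w t * w s = algebraMap k A (J (Fin n) k s t)) :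
    ∃ f : Weyl k n →ₐ[k] A, ∀ s, f (weylGen k n s) = w s := by
  refine ⟨RingQuot.liftAlgHom k ⟨FreeAlgebra.lift k w, ?_⟩, fun s => ?_⟩
  · rintro _ _ (⟨i, j⟩ | ⟨i, j⟩ | ⟨i, j⟩)
    · simpa [J, sub_eq_zero] using hw (.inl i) (.inl j)
    · simpa [J, sub_eq_zero] using hw (.inr i) (.inr j)
    · have := hw (.inr i) (.inl j)
      rw [sub_eq_iff_eq_add'] at this
      by_cases h : i = j <;> simpa [J, h] using this
  · rw [weylGen, RingQuot.liftAlgHom_mkAlgHom_apply, FreeAlgebra.lift_ι_apply]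

theorem weyl_algHom_ext {k : Type} [Field k] {n : ℕ} {A : Type*} [Ring A] [Algebra k A]
    {f f' : Weyl k n →ₐ[k] A} (h : ∀ s, f (weylGen k n s) = f' (weylGen k n s)) : f = f' :=
  RingQuot.ringQuot_ext' k _ _ (FreeAlgebra.hom_ext (funext h))

section AffineFamily

variable {k A ι : Type*} [Field k] [Ring A] [Algebra k A] [Fintype ι]

/-- The family of elements `c_s + ∑ₜ M_{s t} z_t` of an algebra, for a given family `z`. -/
def affineFamily (z : ι → A) (M : Matrix ι ι k) (c : ι → k) (s : ι) : A :=
  algebraMap k A (c s) + ∑ t, M s t • z t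

theorem affineFamily_one_zero [DecidableEq ι] (z : ι → A) (s : ι) :
    affineFamily z (1 : Matrix ι ι k) 0 s = z s := by
  simp [affineFamily, Matrix.one_apply]

theorem algebraMap_add_commutator (a b : k) (u v : A) :
    (algebraMap k A a + u) * (algebraMap k A b + v) -
      (algebraMap k A b + v) * (algebraMap k A a + u) = u * v - v * u := by
  simp only [mul_add, add_mul, Algebra.commutes a v, Algebra.commutes b u,
    Algebra.commutes a (algebraMap k A b)]
  abel

theorem affineFamily_commutator {z : ι → A} {Ω : Matrix ι ι k}
    (hz : ∀ s t, z s * z t - z t * z s = algebraMap k A (Ω s t))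
    (M : Matrix ι ι k) (c : ι → k) (s t : ι) :
    affineFamily z M c s * affineFamily z M c t - affineFamily z M c t * affineFamily z M c s =
      algebraMap k A ((M * Ω * Mᵀ) s t) := by
  rw [affineFamily, affineFamily, algebraMap_add_commutator, Finset.sum_mul_sum,
    Finset.sum_mul_sum, Finset.sum_comm, ← Finset.sum_sub_distrib]
  simp only [Matrix.mul_apply, Matrix.transpose_apply, map_sum, Finset.sum_mul]
  refine Finset.sum_congr rfl fun q _ => ?_
  rw [← Finset.sum_sub_distrib]
  refine Finset.sum_congr rfl fun p _ => ?_
  rw [smul_mul_smul_comm, smul_mul_smul_comm, mul_comm (M t q), ← smul_sub, hz,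
    Algebra.smul_def, ← map_mul, mul_right_comm]

theorem map_affineFamily {B : Type*} [Ring B] [Algebra k B] {z : ι → A} {z' : ι → B}
    {N : Matrix ι ι k} {d : ι → k} {f : A →ₐ[k] B} (hf : ∀ s, f (z s) = affineFamily z' N d s)
    (M : Matrix ι ι k) (c : ι → k) (s : ι) :
    f (affineFamily z M c s) = affineFamily z' (M * N) (c + M *ᵥ d) s := by
  have hconst : ∑ t, M s t • algebraMap k B (d t) = algebraMap k B ((M *ᵥ d) s) := by
    simp [Matrix.mulVec, dotProduct, Algebra.smul_def]
  have hlin : ∑ t, M s t • ∑ u, N t u • z' u = ∑ u, (M * N) s u • z' u := by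
    simp only [Matrix.mul_apply, Finset.sum_smul, Finset.smul_sum, smul_smul]
    exact Finset.sum_comm
  rw [affineFamily, affineFamily, map_add, map_sum, AlgHom.commutes, Pi.add_apply, map_add,
    ← hconst, ← hlin, add_assoc, ← Finset.sum_add_distrib]
  simp only [map_smul, hf, affineFamily, smul_add]

end AffineFamily

theorem exists_affine_of_mem_weylF_one {k : Type} [Field k] {n : ℕ} {a : Weyl k n}
    (ha : a ∈ weylF k n 1) :
    ∃ (b : k) (m : Fin n ⊕ Fin n → k),
      algebraMap k _ b + ∑ t, m t • weylGen k n t = a := by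
  rw [weylF, pow_one, Submodule.mem_sup] at ha
  obtain ⟨u, hu, v, hv, rfl⟩ := ha
  obtain ⟨b, rfl⟩ := Submodule.mem_one.mp hu
  obtain ⟨m, rfl⟩ := (Submodule.mem_span_range_iff_exists_fun k).mp hv
  exact ⟨b, m, rfl⟩

theorem weylGen_mem_weylF_one (k : Type) [Field k] (n : ℕ) (s : Fin n ⊕ Fin n) :
    weylGen k n s ∈ weylF k n 1 := by
  rw [weylF, pow_one]
  exact Submodule.mem_sup_right (Submodule.subset_span ⟨s, rfl⟩)

/-- **Corollary 4.5.** Every filtered endomorphism of the Weyl algebra `A_n` (a `k`-algebra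
endomorphism `g` with `g(F_m) ⊆ F_m` for all `m`, where `F_m = (k·1 + V_n)^m` is the standard
filtration) is an automorphism, i.e. bijective. -/
theorem stmt_3 (k : Type) [Field k] (n : ℕ) (g : Weyl k n →ₐ[k] Weyl k n)
    (hg : ∀ m : ℕ, ∀ a ∈ weylF k n m, g a ∈ weylF k n m) :
    Function.Bijective g := by
  rcases subsingleton_or_nontrivial (Weyl k n) with _ | _
  · exact ⟨Function.injective_of_subsingleton _, Function.surjective_to_subsingleton _⟩
  choose c M hM using fun s =>
    exists_affine_of_mem_weylF_one (hg 1 _ (weylGen_mem_weylF_one k n s))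
  replace hM (s) : g (weylGen k n s) = affineFamily (weylGen k n) (.of M) c s := (hM s).symm
  have hsymp : Matrix.of M ∈ symplecticGroup (Fin n) k := by
    rw [SymplecticGroup.mem_iff]
    ext s t
    apply FaithfulSMul.algebraMap_injective k (Weyl k n)
    rw [← affineFamily_commutator (weylGen_commutator k n) _ c, ← hM, ← hM, ← map_mul,
      ← map_mul, ← map_sub, weylGen_commutator, AlgHom.commutes]
  generalize Matrix.of M = M at hM hsymp
  obtain ⟨⟨N, hN⟩, hMN⟩ : ∃ N, N = (⟨M, hsymp⟩ : symplecticGroup (Fin n) k)⁻¹ := ⟨_, rfl⟩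
  have hNM : N * M = 1 := congrArg Subtype.val (mul_eq_one_iff_eq_inv.mpr hMN)
  have hMN : M * N = 1 := mul_eq_one_comm.mp hNM
  obtain ⟨f, hf⟩ := weyl_exists_algHom (affineFamily (weylGen k n) N (-(N *ᵥ c))) fun s t => by
    rw [affineFamily_commutator (weylGen_commutator k n), SymplecticGroup.mem_iff.mp hN]
  have hfg : f.comp g = AlgHom.id k _ := weyl_algHom_ext fun s => by
    rw [AlgHom.comp_apply, hM, map_affineFamily hf, hMN, Matrix.mulVec_neg,
      Matrix.mulVec_mulVec, hMN, Matrix.one_mulVec, add_neg_cancel, affineFamily_one_zero,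
      AlgHom.id_apply]
  have hgf : g.comp f = AlgHom.id k _ := weyl_algHom_ext fun s => by
    rw [AlgHom.comp_apply, hf, map_affineFamily hM, hNM, neg_add_cancel,
      affineFamily_one_zero, AlgHom.id_apply]
  exact Function.bijective_iff_has_inverse.mpr ⟨f, DFunLike.congr_fun hfg, DFunLike.congr_fun hgf⟩
end

section
/- Let k be a field of characteristic 0 and n ≥ 1, and let sl_{n+1}(k) denote the Lie algebra of traceless (n+1)×(n+1) matrices over k. The map τ : X ↦ −Xᵀ is a Lie algebra automorphism of sl_{n+1}(k), and its determinant as a k-linear endomorphism of sl_{n+1}(k) equals (−1)^{n(n+3)/2}. In particular, det τ = 1 if and only if n ≡ 0 or 1 (mod 4). -/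
open Equiv in
/-- The flip of coordinates on `ι × ι` is an involution fixing exactly the diagonal pairs. -/
theorem Equiv.Perm.sign_prodComm_self (ι : Type*) [Fintype ι] [DecidableEq ι] :
    Perm.sign (prodComm ι ι : Perm (ι × ι)) =
      (-1) ^ (Fintype.card ι * (Fintype.card ι - 1) / 2) := by
  have hsq : (prodComm ι ι : Perm (ι × ι)) ^ 2 = 1 := by
    ext x <;> simp [pow_two]
  let diag : ι ≃ Function.fixedPoints (prodComm ι ι : Perm (ι × ι)) :=
    { toFun i := ⟨(i, i), rfl⟩
      invFun x := x.1.1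
      left_inv _ := rfl
      right_inv x := Subtype.ext (Prod.ext rfl (congrArg Prod.fst x.2.symm :)) }
  rw [Perm.sign_of_pow_two_eq_one hsq, ← Fintype.card_congr diag, Fintype.card_prod,
    Nat.mul_sub_one]

namespace Matrix

/-- Transposition permutes the standard basis of matrices by flipping the index pairs. -/
theorem det_transposeLinearEquiv (ι R : Type*) [Fintype ι] [DecidableEq ι] [CommRing R] :
    LinearMap.det (transposeLinearEquiv ι ι R R : Matrix ι ι R →ₗ[R] Matrix ι ι R) =
      (-1) ^ (Fintype.card ι * (Fintype.card ι - 1) / 2) := by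
  rw [← LinearMap.det_toMatrix (stdBasis R ι ι)]
  have hperm : LinearMap.toMatrix (stdBasis R ι ι) (stdBasis R ι ι)
      (transposeLinearEquiv ι ι R R : Matrix ι ι R →ₗ[R] Matrix ι ι R) =
      Equiv.Perm.permMatrix R (Equiv.prodComm ι ι) := by
    ext ⟨i, j⟩ ⟨i', j'⟩
    by_cases h : j = i' <;>
      simp [LinearMap.toMatrix_apply, stdBasis, Equiv.Perm.permMatrix, PEquiv.toMatrix_apply,
        Pi.single_apply, h]
  rw [hperm, det_permutation, Equiv.Perm.sign_prodComm_self]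
  simp

end Matrix

namespace LieAlgebra.SpecialLinear

open Matrix

variable {ι R : Type*} [Fintype ι] [DecidableEq ι] [CommRing R]

theorem mem_sl_iff {X : Matrix ι ι R} : X ∈ sl ι R ↔ X.trace = 0 :=
  LinearMap.mem_ker

variable (ι R)

/-- The automorphism `X ↦ -Xᵀ` of the special linear Lie algebra. -/
def negTranspose : sl ι R ≃ₗ⁅R⁆ sl ι R where
  toFun X := ⟨-(X : Matrix ι ι R)ᵀ, mem_sl_iff.2 (by simp [mem_sl_iff.1 X.2])⟩
  invFun X := ⟨-(X : Matrix ι ι R)ᵀ, mem_sl_iff.2 (by simp [mem_sl_iff.1 X.2])⟩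
  map_add' X Y := by ext : 1; simp [add_comm]
  map_smul' c X := by ext : 1; simp
  map_lie' {X Y} := by ext : 1; simp [Ring.lie_def, transpose_mul]
  left_inv X := by ext : 1; simp
  right_inv X := by ext : 1; simp

@[simp]
theorem coe_negTranspose (X : sl ι R) :
    (negTranspose ι R X : Matrix ι ι R) = -(X : Matrix ι ι R)ᵀ :=
  rfl

/-- The factor on `gl / sl`, a line on which `X ↦ -Xᵀ` acts as `-1`, is split off from the
determinant on all matrices. -/
theorem det_negTranspose (k : Type*) [Field k] [Nonempty ι] :
    LinearMap.det (negTranspose ι k).toLinearEquiv.toLinearMap =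
      (-1) ^ (Fintype.card ι ^ 2 + 1 + Fintype.card ι * (Fintype.card ι - 1) / 2) := by
  let W : Submodule k (Matrix ι ι k) := LinearMap.ker (traceLinearMap ι k k)
  let e : Matrix ι ι k →ₗ[k] Matrix ι ι k := (-1 : k) • (transposeLinearEquiv ι ι k k).toLinearMap
  have he : W ≤ W.comap e := fun X hX => by
    have hX' : X.trace = 0 := hX
    simp [W, e, hX']
  have hfinrank : Module.finrank k (Matrix ι ι k ⧸ W) = 1 := by
    have hsurj : Function.Surjective (traceLinearMap ι k k) := trace_surjective
    rw [((traceLinearMap ι k k).quotKerEquivOfSurjective hsurj).finrank_eq, Module.finrank_self]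
  have hquot : W.mapQ W e he = (-1 : k) • LinearMap.id := by
    refine Submodule.linearMap_qext _ (LinearMap.ext fun X => ?_)
    suffices W.mkQ (e X) = W.mkQ (-X) by simpa using this
    rw [← sub_eq_zero, ← map_sub, ← LinearMap.mem_ker, Submodule.ker_mkQ]
    simp [W, e]
  have hrestrict : e.restrict he = (negTranspose ι k).toLinearEquiv.toLinearMap := by
    refine LinearMap.ext fun X => Subtype.ext ?_
    exact neg_one_smul k _
  have hdet := LinearMap.det_eq_det_mul_det W e he
  have hmain : LinearMap.det (e.restrict he) =
      LinearMap.det (negTranspose ι k).toLinearEquiv.toLinearMap := congrArg _ hrestrict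
  rw [hquot, hmain, LinearMap.det_smul, LinearMap.det_smul, hfinrank, LinearMap.det_id,
    det_transposeLinearEquiv, Module.finrank_matrix, Module.finrank_self] at hdet
  rw [pow_add, pow_succ, pow_two]
  linear_combination hdet

end LieAlgebra.SpecialLinear

theorem even_mul_add_three_div_two_iff (n : ℕ) :
    Even (n * (n + 3) / 2) ↔ n % 4 = 0 ∨ n % 4 = 1 := by
  obtain ⟨q, r, hr, rfl⟩ : ∃ q r, r < 4 ∧ n = 4 * q + r :=
    ⟨n / 4, n % 4, Nat.mod_lt _ (by norm_num), (Nat.div_add_mod n 4).symm⟩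
  have hexp : (4 * q + r) * (4 * q + r + 3) =
      r * (r + 3) + 4 * (q * (4 * q + 2 * r + 3)) := by ring
  rw [hexp, Nat.even_iff]
  interval_cases r <;> lia

open Matrix in
/-- The type-`A_n` determinant computation in the proof of Corollary 6.4.  Let `k` be a field
of characteristic `0` and `n ≥ 1`.  The map `τ : X ↦ −Xᵀ` is a Lie algebra automorphism of
`sl_{n+1}(k)` (the traceless `(n+1) × (n+1)` matrices), and its determinant as a `k`-linear
endomorphism of `sl_{n+1}(k)` equals `(−1)^{n(n+3)/2}`; in particular `det τ = 1` if and only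
if `n ≡ 0` or `1 (mod 4)`. -/
theorem stmt_8 (k : Type*) [Field k] [CharZero k] (n : ℕ) (hn : 1 ≤ n) :
    ∃ τ : LieAlgebra.SpecialLinear.sl (Fin (n + 1)) k ≃ₗ⁅k⁆
        LieAlgebra.SpecialLinear.sl (Fin (n + 1)) k,
      (∀ X : LieAlgebra.SpecialLinear.sl (Fin (n + 1)) k,
        (τ X : Matrix (Fin (n + 1)) (Fin (n + 1)) k) =
          -((X : Matrix (Fin (n + 1)) (Fin (n + 1)) k)ᵀ)) ∧
      LinearMap.det τ.toLinearEquiv.toLinearMap = (-1 : k) ^ (n * (n + 3) / 2) ∧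
      (LinearMap.det τ.toLinearEquiv.toLinearMap = 1 ↔ n % 4 = 0 ∨ n % 4 = 1) := by
  have hdet : LinearMap.det (LieAlgebra.SpecialLinear.negTranspose
      (Fin (n + 1)) k).toLinearEquiv.toLinearMap = (-1 : k) ^ (n * (n + 3) / 2) := by
    obtain ⟨c, hc⟩ := Nat.even_mul_succ_self n
    have hchoose : (n + 1) * n / 2 = c := by lia
    have hexp : n * (n + 3) / 2 = c + n := by
      rw [show n * (n + 3) = n * (n + 1) + 2 * n by ring]; lia
    have hpow : (n + 1) ^ 2 + 1 + c = (c + n) + 2 * (c + 1) := by linarith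
    rw [LieAlgebra.SpecialLinear.det_negTranspose, Fintype.card_fin, Nat.add_sub_cancel,
      hchoose, hexp, hpow, pow_add, pow_mul]
    simp
  refine ⟨LieAlgebra.SpecialLinear.negTranspose (Fin (n + 1)) k,
    LieAlgebra.SpecialLinear.coe_negTranspose _ _, hdet, ?_⟩
  rw [hdet, neg_one_pow_eq_one_iff_even (by norm_num), even_mul_add_three_div_two_iff]
end

section
/- Let k be a field of characteristic 0 and n ≥ 1, and let so_{2n}(k) denote the Lie algebra of skew-symmetric 2n×2n matrices over k. Let P = diag(1,…,1,−1) be the diagonal orthogonal matrix with last entry −1. The map X ↦ PXP is a Lie algebra automorphism of so_{2n}(k), and its determinant as a k-linear endomorphism of so_{2n}(k) equals −1. -/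
namespace LieAlgebra.Orthogonal

open Matrix

/-- Conjugation by a diagonal matrix squaring to the identity, as an automorphism of the Lie
algebra of skew-symmetric matrices. -/
def soConjDiagonal {R ι : Type*} [CommRing R] [Fintype ι] [DecidableEq ι] (d : ι → R)
    (hd : ∀ i, d i * d i = 1) : so ι R ≃ₗ⁅R⁆ so ι R where
  toFun X := ⟨diagonal d * X * diagonal d, by
    have hX := (mem_so ι R _).1 X.2
    rw [mem_so, transpose_mul, transpose_mul, hX, diagonal_transpose]
    simp [Matrix.mul_assoc]⟩
  invFun X := ⟨diagonal d * X * diagonal d, by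
    have hX := (mem_so ι R _).1 X.2
    rw [mem_so, transpose_mul, transpose_mul, hX, diagonal_transpose]
    simp [Matrix.mul_assoc]⟩
  map_add' X Y := by
    ext i j
    simp [mul_add, add_mul]
  map_smul' r X := by
    ext i j
    simp [mul_assoc]
  map_lie' {X Y} := by
    have hsq : diagonal d * diagonal d = 1 := by simp [hd]
    have key (A B : Matrix ι ι R) : diagonal d * A * diagonal d * (diagonal d * B * diagonal d) =
        diagonal d * (A * B) * diagonal d := by
      calc _ = diagonal d * A * (diagonal d * diagonal d) * B * diagonal d := by
            simp only [Matrix.mul_assoc]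
        _ = _ := by simp only [hsq, Matrix.mul_assoc, Matrix.one_mul]
    apply Subtype.ext
    simp only [LieSubalgebra.coe_bracket, Ring.lie_def, key, mul_sub, sub_mul]
  left_inv X := by
    ext i j
    simp only [diagonal_mul, mul_diagonal]
    linear_combination (X.1 i j * d j * d j) * hd i + X.1 i j * hd j
  right_inv X := by
    ext i j
    simp only [diagonal_mul, mul_diagonal]
    linear_combination (X.1 i j * d j * d j) * hd i + X.1 i j * hd j

/-- A skew-symmetric matrix over a field of characteristic zero is determined by its entries
strictly above the diagonal, which are arbitrary. -/
def soEquivUpper (k ι : Type*) [Field k] [CharZero k] [Fintype ι] [LinearOrder ι] :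
    so ι k ≃ₗ[k] ({p : ι × ι // p.1 < p.2} → k) where
  toFun X p := X.1 p.1.1 p.1.2
  invFun f := ⟨Matrix.of fun i j =>
      if h : i < j then f ⟨(i, j), h⟩ else if h : j < i then -f ⟨(j, i), h⟩ else 0, by
    rw [mem_so]
    ext i j
    rcases lt_trichotomy i j with h | rfl | h
    · simp [h, h.not_gt]
    · simp
    · simp [h, h.not_gt]⟩
  map_add' X Y := rfl
  map_smul' r X := rfl
  left_inv X := by
    have hX (i j : ι) : X.1 j i = -X.1 i j := congrFun₂ ((mem_so ι k _).1 X.2) i j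
    ext i j
    rcases lt_trichotomy i j with h | rfl | h
    · simp [h]
    · simpa using (self_eq_neg.1 (hX i i)).symm
    · simpa [h, h.not_gt] using (hX j i).symm
  right_inv f := by
    ext p
    simp [p.2]

theorem det_soConjDiagonal {k ι : Type*} [Field k] [CharZero k] [Fintype ι] [LinearOrder ι]
    (d : ι → k) (hd : ∀ i, d i * d i = 1) :
    LinearMap.det (soConjDiagonal d hd).toLinearEquiv.toLinearMap =
      ∏ p : {p : ι × ι // p.1 < p.2}, d p.1.1 * d p.1.2 := by
  rw [← LinearMap.det_conj _ (soEquivUpper k ι), ← det_diagonal, ← LinearMap.det_toLin']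
  congr 1
  refine LinearMap.ext fun f => ?_
  obtain ⟨X, rfl⟩ := (soEquivUpper k ι).surjective f
  ext p
  have h : soEquivUpper k ι (soConjDiagonal d hd X) p =
      d p.1.1 * d p.1.2 * soEquivUpper k ι X p := by
    change (diagonal d * X.1 * diagonal d) p.1.1 p.1.2 = d p.1.1 * d p.1.2 * X.1 p.1.1 p.1.2
    simp only [diagonal_mul, mul_diagonal]
    ring
  simpa [mulVec_diagonal] using h

end LieAlgebra.Orthogonal

/-- For the signs `(1, …, 1, -1)`, the product over all pairs `i < j` of the product of the two
signs is `(-1) ^ (m - 1)`. -/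
theorem prod_lt_mul_ite_last {R : Type*} [CommRing R] (m : ℕ) :
    ∏ p : {p : Fin m × Fin m // p.1 < p.2},
      ((if (p.1.1 : ℕ) = m - 1 then (-1 : R) else 1) *
        (if (p.1.2 : ℕ) = m - 1 then (-1 : R) else 1)) = (-1) ^ (m - 1) := by
  rcases m with _ | m
  · simp
  have h (p : {p : Fin (m + 1) × Fin (m + 1) // p.1 < p.2}) :
      ((if (p.1.1 : ℕ) = m + 1 - 1 then (-1 : R) else 1) *
        (if (p.1.2 : ℕ) = m + 1 - 1 then (-1 : R) else 1)) =
      if p.1.2 = Fin.last m then -1 else 1 := by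
    have h₁ : (p.1.1 : ℕ) ≠ m := by have := p.2; have := p.1.2.2; omega
    simp [h₁, Fin.ext_iff]
  simp_rw [h]
  rw [← Finset.prod_subtype (Finset.univ.filter fun p : Fin (m + 1) × Fin (m + 1) => p.1 < p.2)
    (by simp) (fun p => if p.2 = Fin.last m then (-1 : R) else 1), Finset.prod_filter,
    Fintype.prod_prod_type, Fin.prod_univ_castSucc]
  have h₂ (i : Fin m) : (∏ j : Fin (m + 1), if i.castSucc < j then
      (if j = Fin.last m then (-1 : R) else 1) else 1) = -1 := by
    rw [Finset.prod_eq_single (Fin.last m)] <;> simp +contextual [Fin.castSucc_lt_last]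
  have h₃ (j : Fin (m + 1)) : ¬ Fin.last m < j := (Fin.le_last j).not_gt
  simp [h₂, h₃]


/-- The type-`D_n` determinant computation in the proof of Corollary 6.4.  Let `k` be a field
of characteristic `0` and `n ≥ 1`, and let `so_{2n}(k)` be the Lie algebra of skew-symmetric
`2n × 2n` matrices over `k`.  Let `P = diag(1, …, 1, −1)`.  The map `X ↦ P X P` is a Lie
algebra automorphism of `so_{2n}(k)`, and its determinant as a `k`-linear endomorphism of
`so_{2n}(k)` equals `−1`. -/
theorem stmt_9 (k : Type*) [Field k] [CharZero k] (n : ℕ) (hn : 1 ≤ n) :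
    ∃ φ : LieAlgebra.Orthogonal.so (Fin (2 * n)) k ≃ₗ⁅k⁆
        LieAlgebra.Orthogonal.so (Fin (2 * n)) k,
      (∀ X : LieAlgebra.Orthogonal.so (Fin (2 * n)) k,
        (φ X : Matrix (Fin (2 * n)) (Fin (2 * n)) k) =
          Matrix.diagonal (fun i : Fin (2 * n) => if (i : ℕ) = 2 * n - 1 then (-1 : k) else 1) *
            (X : Matrix (Fin (2 * n)) (Fin (2 * n)) k) *
            Matrix.diagonal (fun i : Fin (2 * n) => if (i : ℕ) = 2 * n - 1 then (-1 : k) else 1)) ∧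
      LinearMap.det φ.toLinearEquiv.toLinearMap = -1 := by
  refine ⟨LieAlgebra.Orthogonal.soConjDiagonal _ fun i => by split_ifs <;> simp,
    fun X => rfl, ?_⟩
  rw [LieAlgebra.Orthogonal.det_soConjDiagonal, prod_lt_mul_ite_last]
  exact Odd.neg_one_pow ⟨n - 1, by omega⟩
end

section
/- Let k be a field and A a k-algebra with an exhaustive algebra filtration by k-subspaces F_0 ⊆ F_1 ⊆ F_2 ⊆ ⋯ satisfying F_0 = k·1, F_i·F_j ⊆ F_{i+j}, and ⋃_i F_i = A. Let G be a finite group acting on A by k-algebra automorphisms with g(F_i) = F_i for all g ∈ G and all i, and suppose |G| is invertible in k. Then for every i ≥ 1, the image of F_i ∩ A^G under the quotient map F_i → F_i/F_{i−1} equals the subspace of G-fixed points (F_i/F_{i−1})^G; consequently the associated graded ring of the fixed ring A^G (with the induced filtration F_i ∩ A^G) is the fixed ring (Gr A)^G of the associated graded ring. -/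
/-- **Lemma 3.1(2).**  Let `A` be a `k`-algebra with an exhaustive algebra filtration
`F_0 ⊆ F_1 ⊆ ⋯` with `F_0 = k·1`, `F_i F_j ⊆ F_{i+j}`, `⋃ F_i = A`, and let a finite group
`G` act on `A` by `k`-algebra automorphisms preserving each `F_i`, with `|G|` invertible in
`k`.  Then for each `i ≥ 1` the image of `F_i ∩ A^G` in `F_i / F_{i−1}` equals the `G`-fixed
subspace `(F_i / F_{i−1})^G`: elementwise, the class of `a ∈ F_i` is `G`-fixed (i.e.
`g·a − a ∈ F_{i−1}` for all `g`) if and only if it is the class of some `G`-invariant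
`b ∈ F_i` (i.e. `a − b ∈ F_{i−1}`).  Consequently `Gr(A^G) = (Gr A)^G`. -/
theorem stmt_10 (k : Type*) [Field k] (A : Type*) [Ring A] [Algebra k A]
    (F : ℕ → Submodule k A) (hF0 : F 0 = 1) (hFmono : Monotone F)
    (hFmul : ∀ i j, F i * F j ≤ F (i + j)) (hFexh : ⨆ i, F i = ⊤)
    (G : Type*) [Group G] [Fintype G] (ρ : G →* (A ≃ₐ[k] A))
    (hGF : ∀ (g : G) (i : ℕ), (F i).map (ρ g).toLinearMap = F i)
    (hcard : (Fintype.card G : k) ≠ 0) :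
    ∀ i : ℕ, 1 ≤ i → ∀ a ∈ F i,
      ((∀ g : G, ρ g a - a ∈ F (i - 1)) ↔
        ∃ b ∈ F i, (∀ g : G, ρ g b = b) ∧ a - b ∈ F (i - 1)) := by
  intro i _ a ha
  have h_mem : ∀ (g : G) (j : ℕ) {x : A}, x ∈ F j → ρ g x ∈ F j := fun g j x hx => by
    rw [← hGF g j]
    exact Submodule.mem_map_of_mem hx
  constructor
  · intro h
    refine ⟨(Fintype.card G : k)⁻¹ • ∑ g, ρ g a,
      (F i).smul_mem _ (sum_mem fun g _ => h_mem g i ha), fun g => ?_, ?_⟩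
    · rw [map_smul, map_sum]
      congr 1
      simp_rw [← AlgEquiv.mul_apply, ← map_mul]
      exact Fintype.sum_equiv (Equiv.mulLeft g) _ _ fun _ => rfl
    · have h_avg : a - (Fintype.card G : k)⁻¹ • ∑ g, ρ g a
          = -((Fintype.card G : k)⁻¹ • ∑ g, (ρ g a - a)) := by
        rw [Finset.sum_sub_distrib, Finset.sum_const, Finset.card_univ, smul_sub,
          ← Nat.cast_smul_eq_nsmul k, inv_smul_smul₀ hcard, neg_sub]
      rw [h_avg]
      exact neg_mem ((F (i - 1)).smul_mem _ (sum_mem fun g _ => h g))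
  · rintro ⟨b, -, hb, hab⟩ g
    have h_diff : ρ g a - a = ρ g (a - b) - (a - b) := by
      rw [map_sub, hb g]
      abel
    rw [h_diff]
    exact sub_mem (h_mem g _ hab) hab
end

section
/- Let k be a field of characteristic 2 and let g be the k-algebra automorphism of the polynomial ring k[x] determined by g(x) = x + 1, so g² = id. Then the fixed subalgebra k[x]^G for G = {id, g} equals k[x² + x], the subalgebra generated by x² + x. Consequently, for the standard filtration of k[x] by polynomial degree, the associated graded ring of k[x]^G equals k[x²], which is strictly contained in (Gr k[x])^G = k[x]. -/
open Polynomial in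
theorem Polynomial.aeval_X_add_one_eq_taylor {R : Type*} [CommRing R] (f : R[X]) :
    aeval (X + 1 : R[X]) f = taylor 1 f := by
  rw [taylor_apply, C_1]
  rfl

open Polynomial in
theorem Polynomial.monic_X_sq_add_X (R : Type*) [CommRing R] [Nontrivial R] :
    (X ^ 2 + X : R[X]).Monic := by
  monicity!

open Polynomial in
theorem Polynomial.natDegree_X_sq_add_X (R : Type*) [CommRing R] [Nontrivial R] :
    (X ^ 2 + X : R[X]).natDegree = 2 := by
  compute_degree!

open Polynomial in
theorem Polynomial.aeval_X_add_one_X_sq_add_X (R : Type*) [CommRing R] [CharP R 2] :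
    aeval (X + 1 : R[X]) (X ^ 2 + X : R[X]) = X ^ 2 + X := by
  simp only [map_add, map_pow, aeval_X]
  linear_combination (X + 1 : R[X]) * CharTwo.two_eq_zero (R := R[X])

open Polynomial in
theorem Polynomial.exists_eq_C_add_mul_of_aeval_X_add_one_eq_self {k : Type*} [Field k]
    [CharP k 2] {f : k[X]} (hf : aeval (X + 1 : k[X]) f = f) :
    ∃ (c : k) (h : k[X]), f = C c + (X ^ 2 + X) * h ∧ aeval (X + 1 : k[X]) h = h := by
  have heval : f.eval 1 = f.eval 0 := by
    have := congrArg (eval 0) hf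
    simpa [aeval_X_add_one_eq_taylor, taylor_eval] using this
  obtain ⟨h, hh⟩ : (X ^ 2 + X : k[X]) ∣ f - C (f.eval 0) := by
    have h0 : (X - C 0 : k[X]) ∣ f - C (f.eval 0) := dvd_iff_isRoot.mpr (by simp)
    have h1 : (X - C 1 : k[X]) ∣ f - C (f.eval 0) := dvd_iff_isRoot.mpr (by simp [heval])
    have hmul := (isCoprime_X_sub_C_of_isUnit_sub (R := k) (a := 0) (b := 1)
      (by simp)).mul_dvd h0 h1
    have heq : (X - C 0) * (X - C 1) = (X ^ 2 + X : k[X]) := by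
      simp only [map_zero, map_one]
      linear_combination -(X : k[X]) * CharTwo.two_eq_zero (R := k[X])
    rwa [heq] at hmul
  refine ⟨f.eval 0, h, by rw [← hh]; ring, ?_⟩
  apply mul_left_cancel₀ (monic_X_sq_add_X k).ne_zero
  have := congrArg (aeval (X + 1 : k[X])) hh
  rw [map_mul, aeval_X_add_one_X_sq_add_X, map_sub, hf, aeval_C, algebraMap_eq, hh] at this
  exact this.symm

open Polynomial in
theorem Polynomial.mem_adjoin_and_even_natDegree_of_aeval_X_add_one_eq_self {k : Type*} [Field k]
    [CharP k 2] (f : k[X]) (hf : aeval (X + 1 : k[X]) f = f) :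
    f ∈ Algebra.adjoin k ({X ^ 2 + X} : Set k[X]) ∧ Even f.natDegree := by
  induction hn : f.natDegree using Nat.strong_induction_on generalizing f with
  | _ n ih =>
    obtain ⟨c, h, rfl, hh⟩ := exists_eq_C_add_mul_of_aeval_X_add_one_eq_self hf
    have hc : (C c : k[X]) ∈ Algebra.adjoin k ({X ^ 2 + X} : Set k[X]) :=
      Subalgebra.algebraMap_mem _ c
    by_cases h0 : h = 0
    · subst h0
      simp_all [← hn]
    · have hdeg : n = 2 + h.natDegree := by
        rw [← hn, natDegree_C_add, (monic_X_sq_add_X k).natDegree_mul' h0, natDegree_X_sq_add_X]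
      obtain ⟨hmem, heven⟩ := ih h.natDegree (by omega) h hh rfl
      exact ⟨add_mem hc (mul_mem (Algebra.self_mem_adjoin_singleton k _) hmem),
        hdeg ▸ even_two.add heven⟩

open Polynomial in
/-- **Example 3.2.**  Let `k` be a field of characteristic `2` and `g` the `k`-algebra
automorphism of `k[x]` with `g(x) = x + 1` (so `g² = id`), and `G = {id, g}`.  Then the fixed
ring `k[x]^G` equals `k[x² + x]`, the subalgebra generated by `x² + x`.  Consequently, for the
filtration of `k[x]` by degree, the associated graded ring of `k[x]^G` equals `k[x²]` — i.e.
the degrees of nonzero `G`-invariant polynomials are exactly the even numbers — which is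
strictly contained in `(Gr k[x])^G = k[x]`, since the induced automorphism of
`Gr k[x] = k[x]` is the identity (it preserves degrees and leading coefficients). -/
theorem stmt_11 (k : Type*) [Field k] [CharP k 2] :
    (∀ f : k[X], aeval (X + 1 : k[X]) f = f ↔
        f ∈ Algebra.adjoin k ({X ^ 2 + X} : Set k[X])) ∧
    (∀ f : k[X], aeval (X + 1 : k[X]) f = f → f ≠ 0 → Even f.natDegree) ∧
    (∀ m : ℕ, Even m → ∃ f : k[X], aeval (X + 1 : k[X]) f = f ∧ f.natDegree = m) ∧
    (∀ f : k[X], (aeval (X + 1 : k[X]) f).natDegree = f.natDegree ∧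
        (aeval (X + 1 : k[X]) f).leadingCoeff = f.leadingCoeff) := by
  refine ⟨fun f => ⟨fun hf =>
    (mem_adjoin_and_even_natDegree_of_aeval_X_add_one_eq_self f hf).1, fun hf => ?_⟩,
    fun f hf _ => (mem_adjoin_and_even_natDegree_of_aeval_X_add_one_eq_self f hf).2, ?_, ?_⟩
  · have hle : Algebra.adjoin k ({X ^ 2 + X} : Set k[X]) ≤
        AlgHom.equalizer (aeval (X + 1 : k[X])) (AlgHom.id k k[X]) :=
      Algebra.adjoin_le (Set.singleton_subset_iff.mpr (aeval_X_add_one_X_sq_add_X k))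
    exact hle hf
  · rintro m ⟨n, rfl⟩
    refine ⟨(X ^ 2 + X) ^ n, by rw [map_pow, aeval_X_add_one_X_sq_add_X], ?_⟩
    rw [natDegree_pow, natDegree_X_sq_add_X, mul_two]
  · intro f
    rw [aeval_X_add_one_eq_taylor]
    exact ⟨natDegree_taylor f 1, leadingCoeff_taylor 1 f⟩
end
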